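/- Let G be a connected graph and T a subtree of G, maximal in order among subtrees whose stem has exactly k branch vertices, with T not spanning G. Suppose u ∈ Leaf(T) is adjacent in G to some vertex v ∈ V(G) \ V(T). If u is adjacent in G to a vertex w of Stem(T), then deg_{Stem(T)}(w) = 2. -/

import Mathlib

open SimpleGraph

noncomputable def sdeg {V : Type*} {G : SimpleGraph V} (T : G.Subgraph) (v : V) : ℕ :=
  (T.neighborSet v).ncard

def sleaf {V : Type*} {G : SimpleGraph V} (T : G.Subgraph) : Set V :=
  {v | v ∈ T.verts ∧ sdeg T v = 1}

noncomputable def sstemDeg {V : Type*} {G : SimpleGraph V} (T : G.Subgraph) (w : V) : ℕ :=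
  {x | T.Adj w x ∧ w ∉ sleaf T ∧ x ∉ sleaf T}.ncard

def sbranch {V : Type*} {G : SimpleGraph V} (T : G.Subgraph) : Set V :=
  {w | 3 ≤ sstemDeg T w}

section LeafRelocation

variable {V : Type*} {G : SimpleGraph V} {T : G.Subgraph} {u v w p : V}

/-- Detach `u` from its neighbours in `T`, attach it to `w` instead, and hang `v` from `u`. -/
def relocateLeaf (T : G.Subgraph) (u v w : V) (hu : u ∈ T.verts) (hw : w ∈ T.verts)
    (huv : G.Adj u v) (huw : G.Adj u w) : G.Subgraph where
  verts := insert v T.verts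
  Adj x y := (T.Adj x y ∧ x ≠ u ∧ y ≠ u) ∨ (x = u ∧ y = w) ∨ (x = w ∧ y = u) ∨
    (x = u ∧ y = v) ∨ (x = v ∧ y = u)
  adj_sub := by
    rintro x y (h | ⟨rfl, rfl⟩ | ⟨rfl, rfl⟩ | ⟨rfl, rfl⟩ | ⟨rfl, rfl⟩)
    exacts [h.1.adj_sub, huw, huw.symm, huv, huv.symm]
  edge_vert := by
    rintro x y (h | ⟨rfl, rfl⟩ | ⟨rfl, rfl⟩ | ⟨rfl, rfl⟩ | ⟨rfl, rfl⟩)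
    exacts [Or.inr h.1.fst_mem, Or.inr hu, Or.inr hw, Or.inr hu, Or.inl rfl]
  symm := ⟨by
    rintro x y (h | h | h | h | h)
    · exact Or.inl ⟨h.1.symm, h.2.2, h.2.1⟩
    all_goals simp [h]⟩

/-- A property of vertices passing along the edges of a connected subgraph holds throughout. -/
theorem SimpleGraph.Subgraph.Connected.forall_of_adj {H : G.Subgraph} (hH : H.coe.Connected)
    (P : V → Prop) {a : V} (ha : a ∈ H.verts) (h0 : P a)
    (hstep : ∀ x y, H.Adj x y → P x → P y) {b : V} (hb : b ∈ H.verts) : P b := by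
  obtain ⟨q⟩ := hH.preconnected ⟨a, ha⟩ ⟨b, hb⟩
  have key : ∀ (x y : H.verts), H.coe.Walk x y → P x → P y := by
    intro x y q
    induction q with
    | nil => exact id
    | cons h _ ih => exact fun hx => ih (hstep _ _ h hx)
  exact key _ _ q h0

theorem SimpleGraph.Subgraph.card_coe_edgeSet (H : G.Subgraph) :
    Nat.card H.coe.edgeSet = H.edgeSet.ncard := by
  rw [← H.image_coe_edgeSet_coe,
    Set.ncard_image_of_injective _ (Sym2.map.injective Subtype.val_injective),
    Nat.card_coe_set_eq]

theorem relocateLeaf_connected (hT : T.coe.Connected) (hu : u ∈ T.verts) (hw : w ∈ T.verts)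
    (huv : G.Adj u v) (huw : G.Adj u w) (hp : ∀ x, T.Adj u x ↔ x = p) :
    (relocateLeaf T u v w hu hw huv huw).coe.Connected := by
  set H := relocateLeaf T u v w hu hw huv huw with hH
  have hup : u ≠ p := ((hp p).2 rfl).ne
  let R : V → Prop := fun y => ∃ hy : y ∈ H.verts, H.coe.Reachable ⟨w, Or.inr hw⟩ ⟨y, hy⟩
  have step : ∀ x y, H.Adj x y → R x → R y := fun x y h ⟨_, hr⟩ =>
    ⟨H.edge_vert h.symm, hr.trans (Adj.reachable (by exact h))⟩
  have hRw : R w := ⟨Or.inr hw, Reachable.refl _⟩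
  have hRu : R u := step w u (by simp [hH, relocateLeaf]) hRw
  have hRv : R v := step u v (by simp [hH, relocateLeaf]) hRu
  have hRT : ∀ y ∈ T.verts, (y ≠ u → R y) ∧ (y = u → R p) := by
    intro y hy
    refine SimpleGraph.Subgraph.Connected.forall_of_adj hT
      (fun y => (y ≠ u → R y) ∧ (y = u → R p)) hw ⟨fun _ => hRw, fun h => (huw.ne h.symm).elim⟩
      ?_ hy
    rintro x y hxy ⟨h1, h2⟩
    by_cases hx : x = u
    · subst hx
      obtain rfl := (hp y).1 hxy
      exact ⟨fun _ => h2 rfl, fun h => (hup h.symm).elim⟩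
    · refine ⟨fun hy => step x y (Or.inl ⟨hxy, hx, hy⟩) (h1 hx), ?_⟩
      rintro rfl
      obtain rfl := (hp x).1 hxy.symm
      exact h1 hx
  rw [connected_iff_exists_forall_reachable]
  refine ⟨⟨w, Or.inr hw⟩, ?_⟩
  rintro ⟨y, hy⟩
  have hy' : R y := by
    rcases hy with rfl | hy
    · exact hRv
    · by_cases h : y = u
      · exact h ▸ hRu
      · exact (hRT y hy).1 h
  exact hy'.2

theorem relocateLeaf_isTree [Finite V] (hT : T.coe.IsTree) (hu : u ∈ T.verts) (hw : w ∈ T.verts)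
    (huv : G.Adj u v) (huw : G.Adj u w) (hp : ∀ x, T.Adj u x ↔ x = p) (hv : v ∉ T.verts) :
    (relocateLeaf T u v w hu hw huv huw).coe.IsTree := by
  rw [isTree_iff_connected_and_card] at hT ⊢
  refine ⟨relocateLeaf_connected hT.1 hu hw huv huw hp, ?_⟩
  have hcard := hT.2
  rw [Subgraph.card_coe_edgeSet, Nat.card_coe_set_eq] at hcard ⊢
  have hE : (relocateLeaf T u v w hu hw huv huw).edgeSet =
      insert s(u, v) (insert s(u, w) (T.edgeSet \ {s(u, p)})) := by
    ext e
    induction e with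
    | h x y =>
      have h1 := hp x
      have h2 := hp y
      have h3 := T.adj_comm x y
      simp only [Subgraph.mem_edgeSet, relocateLeaf, Set.mem_insert_iff, Set.mem_sdiff,
        Set.mem_singleton_iff, Sym2.eq_iff]
      grind
  have hpT : s(u, p) ∈ T.edgeSet := (hp p).2 rfl
  have hvw : v ≠ w := fun h => hv (h ▸ hw)
  have h1 : s(u, w) ∉ T.edgeSet \ {s(u, p)} := by
    rintro ⟨h, h'⟩
    exact h' (by rw [(hp w).1 h]; rfl)
  have h2 : s(u, v) ∉ insert s(u, w) (T.edgeSet \ {s(u, p)}) := by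
    rintro (h | h)
    · have := huv.ne
      grind [Sym2.eq_iff]
    · exact hv (T.edge_vert (Subgraph.Adj.symm (Subgraph.mem_edgeSet.1 h.1)))
  have h3 := Set.ncard_sdiff_singleton_add_one hpT
  rw [hE, Set.ncard_insert_of_notMem h2, Set.ncard_insert_of_notMem h1]
  have hV : (relocateLeaf T u v w hu hw huv huw).verts.ncard = T.verts.ncard + 1 :=
    Set.ncard_insert_of_notMem hv
  rw [hV]
  omega

theorem mem_sleaf_relocateLeaf [Finite V] (hu : u ∈ T.verts) (hw : w ∈ T.verts)
    (huv : G.Adj u v) (huw : G.Adj u w) (hp : ∀ x, T.Adj u x ↔ x = p) (hv : v ∉ T.verts)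
    (hwleaf : w ∉ sleaf T) (hwpos : sdeg T w ≠ 0) (hdeg : w = p ∨ 3 ≤ sdeg T p) (x : V) :
    x ∈ sleaf (relocateLeaf T u v w hu hw huv huw) ↔ (x ∈ sleaf T ∧ x ≠ u) ∨ x = v := by
  have hvw : v ≠ w := fun h => hv (h ▸ hw)
  have huv' := huv.ne
  have huw' := huw.ne
  have hup : u ≠ p := ((hp p).2 rfl).ne
  have hpT : p ∈ T.verts := T.edge_vert ((hp p).2 rfl).symm
  have hTv : ∀ y, ¬ T.Adj v y := fun y h => hv h.fst_mem
  have hTv' : ∀ y, ¬ T.Adj y v := fun y h => hv h.snd_mem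
  have hpu : ∀ y, T.Adj y u ↔ y = p := fun y => by rw [T.adj_comm, hp]
  have hw1 : sdeg T w ≠ 1 := fun h => hwleaf ⟨hw, h⟩
  simp only [sleaf, Set.mem_ofPred_eq]
  set H := relocateLeaf T u v w hu hw huv huw with hH
  have hadj : ∀ x y, y ∈ H.neighborSet x ↔ ((T.Adj x y ∧ x ≠ u ∧ y ≠ u) ∨ (x = u ∧ y = w) ∨
    (x = w ∧ y = u) ∨ (x = u ∧ y = v) ∨ (x = v ∧ y = u)) := fun x y => Iff.rfl
  have hverts : x ∈ H.verts ↔ x = v ∨ x ∈ T.verts := Iff.rfl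
  rw [hverts]
  by_cases hxv : x = v
  · subst hxv
    have : H.neighborSet x = {u} := by
      ext y; rw [hadj]; simp only [Set.mem_singleton_iff]; grind
    simp [sdeg, this]
  by_cases hxu : x = u
  · subst hxu
    have : H.neighborSet x = {w, v} := by
      ext y; rw [hadj]; simp only [Set.mem_singleton_iff, Set.mem_insert_iff]; grind
    simp [sdeg, this, Set.ncard_pair hvw.symm, hxv]
  by_cases hxw : x = w
  · subst hxw
    have : H.neighborSet x = insert u (T.neighborSet x) := by
      ext y; rw [hadj]; simp only [Set.mem_insert_iff, Subgraph.mem_neighborSet]; grind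
    have hle : sdeg T x ≤ sdeg H x := by
      unfold sdeg; rw [this]; exact Set.ncard_le_ncard (Set.subset_insert _ _)
    have : sdeg H x ≠ 1 := by omega
    simp [this, hw1, hxv]
  by_cases hxp : x = p
  · subst hxp
    have : H.neighborSet x = T.neighborSet x \ {u} := by
      ext y; rw [hadj]
      simp only [Set.mem_sdiff, Set.mem_singleton_iff, Subgraph.mem_neighborSet]; grind
    have h3 := hdeg.resolve_left (Ne.symm hxw)
    have hmem : u ∈ T.neighborSet x := (hpu x).2 rfl
    have h4 := Set.ncard_sdiff_singleton_add_one hmem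
    rw [← this] at h4
    unfold sdeg at h3 ⊢
    grind
  · have : H.neighborSet x = T.neighborSet x := by
      ext y; rw [hadj]; simp only [Subgraph.mem_neighborSet]; grind
    simp [sdeg, this, hxv, hxu]

theorem sbranch_relocateLeaf [Finite V] (huleaf : u ∈ sleaf T) (hw : w ∈ T.verts)
    (huv : G.Adj u v) (huw : G.Adj u w) (hp : ∀ x, T.Adj u x ↔ x = p) (hv : v ∉ T.verts)
    (hwleaf : w ∉ sleaf T) (hwpos : sdeg T w ≠ 0) (hdeg : w = p ∨ 3 ≤ sdeg T p)
    (h2 : sstemDeg T w ≠ 2) :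
    sbranch (relocateLeaf T u v w huleaf.1 hw huv huw) = sbranch T := by
  have hleaf := mem_sleaf_relocateLeaf huleaf.1 hw huv huw hp hv hwleaf hwpos hdeg
  set H := relocateLeaf T u v w huleaf.1 hw huv huw with hH
  have hvw : v ≠ w := fun h => hv (h ▸ hw)
  have huv' := huv.ne
  have huw' := huw.ne
  have hstem : ∀ x y, (H.Adj x y ∧ x ∉ sleaf H ∧ y ∉ sleaf H) ↔
      ((T.Adj x y ∧ x ∉ sleaf T ∧ y ∉ sleaf T) ∨ (x = w ∧ y = u) ∨ (x = u ∧ y = w)) := by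
    intro x y
    have hx : T.Adj x y → x ≠ v := fun h e => hv (e ▸ h.fst_mem)
    have hy : T.Adj x y → y ≠ v := fun h e => hv (e ▸ h.snd_mem)
    rw [hleaf, hleaf]
    have : H.Adj x y ↔ ((T.Adj x y ∧ x ≠ u ∧ y ≠ u) ∨ (x = u ∧ y = w) ∨
      (x = w ∧ y = u) ∨ (x = u ∧ y = v) ∨ (x = v ∧ y = u)) := Iff.rfl
    rw [this]
    grind
  ext x
  simp only [sbranch, Set.mem_ofPred_eq]
  unfold sstemDeg at h2 ⊢
  simp only [hstem]
  by_cases hxu : x = u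
  · subst hxu
    simp [huleaf, huw']
  by_cases hxw : x = w
  · subst hxw
    have : {y | (T.Adj x y ∧ x ∉ sleaf T ∧ y ∉ sleaf T) ∨ (x = x ∧ y = u) ∨ (x = u ∧ y = x)} =
        insert u {y | T.Adj x y ∧ x ∉ sleaf T ∧ y ∉ sleaf T} := by
      ext y
      simp only [Set.mem_ofPred_eq, Set.mem_insert_iff]
      grind
    rw [this, Set.ncard_insert_of_notMem (by simp [huleaf])]
    omega
  · simp [hxu, hxw]

theorem sstemDeg_eq_two_of_maximal [Finite V] (hT : T.coe.IsTree)
    (hmax : ∀ T' : G.Subgraph, T'.coe.IsTree → (sbranch T').ncard = (sbranch T).ncard →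
      T'.verts.ncard ≤ T.verts.ncard)
    (huleaf : u ∈ sleaf T) (hw : w ∈ T.verts)
    (huv : G.Adj u v) (huw : G.Adj u w) (hp : ∀ x, T.Adj u x ↔ x = p) (hv : v ∉ T.verts)
    (hwleaf : w ∉ sleaf T) (hdeg : w = p ∨ 3 ≤ sdeg T p) : sstemDeg T w = 2 := by
  by_contra h2
  have hwpos : sdeg T w ≠ 0 := by
    intro h0
    have hempty : T.neighborSet w = ∅ := (Set.ncard_eq_zero).1 h0
    refine huw.ne (SimpleGraph.Subgraph.Connected.forall_of_adj hT.connected (· = w) hw rfl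
      ?_ huleaf.1)
    rintro x y hxy rfl
    have : y ∈ T.neighborSet x := hxy
    simp [hempty] at this
  have hle := hmax _ (relocateLeaf_isTree hT huleaf.1 hw huv huw hp hv)
    (by rw [sbranch_relocateLeaf huleaf hw huv huw hp hv hwleaf hwpos hdeg h2])
  have hV : (relocateLeaf T u v w huleaf.1 hw huv huw).verts.ncard = T.verts.ncard + 1 :=
    Set.ncard_insert_of_notMem hv
  omega

end LeafRelocation

theorem stmt12 {V : Type*} [Fintype V] (G : SimpleGraph V) (hG : G.Connected) (k : ℕ)
    (T : G.Subgraph) (hT : T.coe.IsTree)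
    (hk : (sbranch T).ncard = k)
    (hmax : ∀ T' : G.Subgraph, T'.coe.IsTree → (sbranch T').ncard = k →
      T'.verts.ncard ≤ T.verts.ncard)
    (hns : T.verts ≠ Set.univ)
    (u v : V) (hu : u ∈ sleaf T) (hv : v ∉ T.verts) (huv : G.Adj u v)
    (w : V) (hw : w ∈ T.verts) (hwleaf : w ∉ sleaf T) (huw : G.Adj u w) :
    sstemDeg T w = 2 := by
  subst hk
  obtain ⟨p, hpN⟩ := Set.ncard_eq_one.1 hu.2
  have hp : ∀ x, T.Adj u x ↔ x = p := fun x => by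
    rw [← Subgraph.mem_neighborSet, hpN, Set.mem_singleton_iff]
  have hup : T.Adj u p := (hp p).2 rfl
  have hpleaf : p ∉ sleaf T := by
    rintro ⟨hpT, hp1⟩
    obtain ⟨q, hq⟩ := Set.ncard_eq_one.1 hp1
    have hpq : ∀ x, T.Adj p x ↔ x = q := fun x => by
      rw [← Subgraph.mem_neighborSet, hq, Set.mem_singleton_iff]
    obtain rfl := (hpq u).1 hup.symm
    have hwup : w = u ∨ w = p := by
      refine SimpleGraph.Subgraph.Connected.forall_of_adj hT.connected (fun x => x = u ∨ x = p)
        hu.1 (Or.inl rfl) ?_ hw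
      rintro x y hxy (rfl | rfl)
      exacts [Or.inr ((hp y).1 hxy), Or.inl ((hpq y).1 hxy)]
    rcases hwup with rfl | rfl
    exacts [hwleaf hu, hwleaf ⟨hpT, hp1⟩]
  have hp2 : sstemDeg T p = 2 := sstemDeg_eq_two_of_maximal hT hmax hu
    (T.edge_vert hup.symm) huv hup.adj_sub hp hv hpleaf (Or.inl rfl)
  refine sstemDeg_eq_two_of_maximal hT hmax hu hw huv huw hp hv hwleaf (Or.inr ?_)
  have hins : insert u {x | T.Adj p x ∧ p ∉ sleaf T ∧ x ∉ sleaf T} ⊆ T.neighborSet p :=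
    Set.insert_subset hup.symm fun x hx => hx.1
  have hle := Set.ncard_le_ncard hins
  rw [Set.ncard_insert_of_notMem (by simp [hu])] at hle
  unfold sstemDeg at hp2
  unfold sdeg
  omega
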